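/- Let K be a variety of De Morgan monoids. Then K is passively structurally complete if and only if exactly one of the following holds: (i) K is the variety V(2) of Boolean algebras; (ii) K = V(D4); (iii) K consists of odd Sugihara monoids; (iv) K is a nontrivial subvariety of the variety M of De Morgan monoids satisfying e ≤ f, x ≤ f², and f²·¬((f·x) ∧ (f·¬x)) = f². -/

import Mathlib

universe u

open FirstOrder Language Structure

namespace Paper

variable {L : FirstOrder.Language.{u, u}}

/-- Existential positive sentences/formulas: built from atomic formulas by
conjunction, disjunction and existential quantification. -/
inductive IsEP : {n : ℕ} → L.BoundedFormula Empty n → Prop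
  | equal {n} (t₁ t₂ : L.Term (Empty ⊕ Fin n)) : IsEP (t₁.bdEqual t₂)
  | rel {n k} (R : L.Relations k) (ts : Fin k → L.Term (Empty ⊕ Fin n)) :
      IsEP (BoundedFormula.rel R ts)
  | sup {n} {φ ψ : L.BoundedFormula Empty n} : IsEP φ → IsEP ψ → IsEP (φ ⊔ ψ)
  | inf {n} {φ ψ : L.BoundedFormula Empty n} : IsEP φ → IsEP ψ → IsEP (φ ⊓ ψ)
  | ex {n} {φ : L.BoundedFormula Empty (n + 1)} : IsEP φ → IsEP φ.ex

/-- The direct-product structure on a product of structures. -/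
def piStructure {ι : Type u} (M : ι → Type u) [∀ i, L.Structure (M i)] :
    L.Structure (∀ i, M i) where
  funMap f x i := funMap f fun j => x j i
  RelMap r x := ∀ i, RelMap r fun j => x j i

/-- An (abstract) class of `L`-structures with universes in `Type u`. -/
def StructClass (L : FirstOrder.Language.{u, u}) : Type (u + 1) :=
  ∀ M : Type u, L.Structure M → Prop

def SubClass (K₁ K₂ : StructClass L) : Prop :=
  ∀ (M : Type u) (iM : L.Structure M), K₁ M iM → K₂ M iM

def EqClass (K₁ K₂ : StructClass L) : Prop :=
  ∀ (M : Type u) (iM : L.Structure M), K₁ M iM ↔ K₂ M iM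

/-- A quasivariety: a class of structures closed under isomorphisms,
substructures, direct products and ultraproducts. -/
structure IsQuasivariety (K : StructClass L) : Prop where
  iso_closed : ∀ (M : Type u) [iM : L.Structure M] (N : Type u) [iN : L.Structure N],
      Nonempty (M ≃[L] N) → K M iM → K N iN
  sub_closed : ∀ (M : Type u) [iM : L.Structure M] (N : Type u) [iN : L.Structure N],
      Nonempty (M ↪[L] N) → K N iN → K M iM
  prod_closed : ∀ (ι : Type u) (M : ι → Type u) [iM : ∀ i, L.Structure (M i)],
      (∀ i, K (M i) (iM i)) → K (∀ i, M i) (piStructure M)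
  ultra_closed : ∀ (ι : Type u) (M : ι → Type u) [iM : ∀ i, L.Structure (M i)]
      (uf : Ultrafilter ι), (∀ i, K (M i) (iM i)) →
      K ((uf : Filter ι).Product M) inferInstance

/-- A variety: a class of structures closed under isomorphisms, homomorphic
images, substructures and direct products. -/
structure IsVariety (K : StructClass L) : Prop where
  iso_closed : ∀ (M : Type u) [iM : L.Structure M] (N : Type u) [iN : L.Structure N],
      Nonempty (M ≃[L] N) → K M iM → K N iN
  hom_closed : ∀ (M : Type u) [iM : L.Structure M] (N : Type u) [iN : L.Structure N],
      (∃ h : M →[L] N, Function.Surjective h) → K M iM → K N iN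
  sub_closed : ∀ (M : Type u) [iM : L.Structure M] (N : Type u) [iN : L.Structure N],
      Nonempty (M ↪[L] N) → K N iN → K M iM
  prod_closed : ∀ (ι : Type u) (M : ι → Type u) [iM : ∀ i, L.Structure (M i)],
      (∀ i, K (M i) (iM i)) → K (∀ i, M i) (piStructure M)

/-- The quasivariety generated by a class. -/
def QGen (C : StructClass L) : StructClass L :=
  fun M iM => ∀ K : StructClass L, IsQuasivariety K → SubClass C K → K M iM

/-- The variety generated by a class. -/
def VGen (C : StructClass L) : StructClass L :=
  fun M iM => ∀ K : StructClass L, IsVariety K → SubClass C K → K M iM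

/-- The class of isomorphic copies of a single structure. -/
def ClassOf (A : Type u) [iA : L.Structure A] : StructClass L :=
  fun M iM => Nonempty (@FirstOrder.Language.Equiv L M A iM iA)

/-- A class is nontrivial when it has a member with at least two elements. -/
def NontrivialClass (K : StructClass L) : Prop :=
  ∃ (M : Type u) (iM : L.Structure M), K M iM ∧ Nontrivial M

/-- The joint embedding property. -/
def HasJEP (K : StructClass L) : Prop :=
  ∀ (A : Type u) [iA : L.Structure A] (B : Type u) [iB : L.Structure B],
    K A iA → K B iB → Nontrivial A → Nontrivial B →
    ∃ (C : Type u) (iC : L.Structure C), K C iC ∧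
      Nonempty (@FirstOrder.Language.Embedding L A C iA iC) ∧
      Nonempty (@FirstOrder.Language.Embedding L B C iB iC)

/-- There is a homomorphism from `A` into some ultrapower of `B`. -/
def MapsIntoUltrapower (L : FirstOrder.Language.{u, u}) (A B : Type u)
    [iA : L.Structure A] [iB : L.Structure B] : Prop :=
  ∃ (ι : Type u) (uf : Ultrafilter ι),
    Nonempty (A →[L] ((uf : Filter ι).Product fun _ : ι => B))

/-- There is an embedding of `A` into some ultrapower of `B`. -/
def EmbedsIntoUltrapower (L : FirstOrder.Language.{u, u}) (A B : Type u)
    [iA : L.Structure A] [iB : L.Structure B] : Prop :=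
  ∃ (ι : Type u) (uf : Ultrafilter ι),
    Nonempty (A ↪[L] ((uf : Filter ι).Product fun _ : ι => B))

/-- Passive structural completeness: all nontrivial members satisfy the same
existential positive sentences. -/
def IsPSC (K : StructClass L) : Prop :=
  ∀ (A : Type u) [iA : L.Structure A] (B : Type u) [iB : L.Structure B],
    K A iA → K B iB → Nontrivial A → Nontrivial B →
    ∀ φ : L.Sentence, IsEP φ → (A ⊨ φ → B ⊨ φ)

/-- A relatively simple (K-simple) member of `K`. -/
def RelSimple (K : StructClass L) (A : Type u) [iA : L.Structure A] : Prop :=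
  K A iA ∧ Nontrivial A ∧
    ∀ (B : Type u) [iB : L.Structure B], K B iB → Nontrivial B →
      ∀ h : A →[L] B, Function.Surjective h → Function.Injective h

/-- The class of relatively simple members of `K`. -/
def RelSimpleClass (K : StructClass L) : StructClass L :=
  fun A iA => @RelSimple L K A iA

/-- A relatively subdirectly irreducible member of `K`. -/
def RelSDI (K : StructClass L) (A : Type u) [iA : L.Structure A] : Prop :=
  K A iA ∧
    ∀ (ι : Type u) (M : ι → Type u) [iM : ∀ i, L.Structure (M i)],
      (∀ i, K (M i) (iM i)) →
      ∀ h : @FirstOrder.Language.Embedding L A (∀ i, M i) iA (piStructure M),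
        (∀ i, Function.Surjective fun a => h a i) →
        ∃ i, Function.Bijective fun a => h a i

/-- The class of relatively subdirectly irreducible members of `K`. -/
def RelSDIClass (K : StructClass L) : StructClass L :=
  fun A iA => @RelSDI L K A iA

/-- `K` is relatively semisimple. -/
def RelSemisimple (K : StructClass L) : Prop :=
  ∀ (M : Type u) [iM : L.Structure M], K M iM → RelSDI K M → RelSimple K M

/-- A congruence of a structure. -/
def IsCong (L : FirstOrder.Language.{u, u}) (A : Type u) [iA : L.Structure A] (θ : Setoid A) : Prop :=
  (∀ (n : ℕ) (f : L.Functions n) (x y : Fin n → A),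
      (∀ i, θ.r (x i) (y i)) → θ.r (funMap f x) (funMap f y)) ∧
  (∀ (n : ℕ) (r : L.Relations n) (x y : Fin n → A),
      (∀ i, θ.r (x i) (y i)) → (RelMap r x ↔ RelMap r y))

/-- The prestructure determined by a congruence. -/
def congPrestructure (L : FirstOrder.Language.{u, u}) (A : Type u) [iA : L.Structure A]
    (θ : Setoid A) (h : IsCong L A θ) : L.Prestructure θ where
  toStructure := iA
  fun_equiv := fun x y hxy => h.1 _ _ x y fun i => hxy i
  rel_equiv := fun x y hxy => propext (h.2 _ _ x y fun i => hxy i)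

/-- The quotient structure by a congruence. -/
def quotStructure (L : FirstOrder.Language.{u, u}) (A : Type u) [iA : L.Structure A]
    (θ : Setoid A) (h : IsCong L A θ) : L.Structure (Quotient θ) :=
  @FirstOrder.Language.quotientStructure L A θ (congPrestructure L A θ h)

/-- A `K`-congruence (relative congruence) of `A`. -/
def IsKCong (K : StructClass L) (A : Type u) [iA : L.Structure A] (θ : Setoid A) : Prop :=
  ∃ h : IsCong L A θ, K (Quotient θ) (quotStructure L A θ h)

/-- The total relation `A × A` is a compact element of the lattice of
`K`-congruences of `A`. -/
def TopKCompact (K : StructClass L) (A : Type u) [iA : L.Structure A] : Prop :=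
  ∀ S : Set (Setoid A), (∀ θ ∈ S, IsKCong K A θ) →
    (∀ θ : Setoid A, IsKCong K A θ → (∀ σ ∈ S, σ ≤ θ) → θ = ⊤) →
    ∃ S₀ : Set (Setoid A), S₀ ⊆ S ∧ S₀.Finite ∧
      ∀ θ : Setoid A, IsKCong K A θ → (∀ σ ∈ S₀, σ ≤ θ) → θ = ⊤

/-- `A` has a homomorphic image in `K` that is `K`-simple. -/
def HasRelSimpleImage (K : StructClass L) (A : Type u) [iA : L.Structure A] : Prop :=
  ∃ (B : Type u) (iB : L.Structure B), K B iB ∧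
    (∃ h : @FirstOrder.Language.Hom L A B iA iB, Function.Surjective h) ∧
    @RelSimple L K B iB

/-- The language has finitely many operation and relation symbols. -/
def FiniteType (L : FirstOrder.Language.{u, u}) : Prop :=
  Finite (Σ n, L.Functions n) ∧ Finite (Σ n, L.Relations n)

/-- An algebra is `0`-generated when it is generated by the empty set. -/
def ZeroGen (L : FirstOrder.Language.{u, u}) (A : Type u) [iA : L.Structure A] : Prop :=
  Substructure.closure L (∅ : Set A) = ⊤

/-- `A` has a one-element (trivial) subalgebra. -/
def HasOneElemSub (L : FirstOrder.Language.{u, u}) (A : Type u) [iA : L.Structure A] : Prop :=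
  ∃ c : A, ∀ (n : ℕ) (f : L.Functions n), funMap f (fun _ => c) = c

/-- A Kollár class: nontrivial members have no trivial subalgebra. -/
def IsKollar (K : StructClass L) : Prop :=
  ∀ (M : Type u) [iM : L.Structure M], K M iM → Nontrivial M → ¬ HasOneElemSub L M

/-- `A` is a retract of `B`. -/
def IsRetractOf (L : FirstOrder.Language.{u, u}) (A B : Type u)
    [iA : L.Structure A] [iB : L.Structure B] : Prop :=
  ∃ (g : A →[L] B) (h : B →[L] A), ∀ a : A, h (g a) = a

/-- Validity of an equation in a class. -/
def EqValid (K : StructClass L) (t₁ t₂ : L.Term ℕ) : Prop :=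
  ∀ (M : Type u) [iM : L.Structure M], K M iM →
    ∀ v : ℕ → M, t₁.realize v = t₂.realize v

/-- Validity of a quasi-equation (with premise set `Γ`) in a class. -/
def QEqValid (K : StructClass L) (Γ : Set (L.Term ℕ × L.Term ℕ))
    (t₁ t₂ : L.Term ℕ) : Prop :=
  ∀ (M : Type u) [iM : L.Structure M], K M iM → ∀ v : ℕ → M,
    (∀ p ∈ Γ, Term.realize v p.1 = Term.realize v p.2) →
    t₁.realize v = t₂.realize v

/-- A set of equations is unifiable over `K`. -/
def Unifiable (K : StructClass L) (Γ : Set (L.Term ℕ × L.Term ℕ)) : Prop :=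
  ∃ h : ℕ → L.Term ℕ, ∀ p ∈ Γ, EqValid K (p.1.subst h) (p.2.subst h)

/-- No quasi-equation is passive over `K`: every finite set of equations is
unifiable over `K`. -/
def NoPassiveQEq (K : StructClass L) : Prop :=
  ∀ Γ : Set (L.Term ℕ × L.Term ℕ), Γ.Finite → Unifiable K Γ

/-- The set of variables occurring in a set of equations. -/
def EqnsVars (Γ : Set (L.Term ℕ × L.Term ℕ)) : Set ℕ :=
  ⋃ p ∈ Γ, (↑(p.1.varFinset ∪ p.2.varFinset) : Set ℕ)

/-- `F` is a free `1`-generated algebra for `K`, with free generator `x`. -/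
def IsFreeOne (K : StructClass L) (F : Type u) [iF : L.Structure F] (x : F) : Prop :=
  K F iF ∧ Substructure.closure L ({x} : Set F) = ⊤ ∧
    ∀ (M : Type u) [iM : L.Structure M], K M iM → ∀ m : M,
      ∃ h : F →[L] M, h x = m

/-- A minimal quasivariety. -/
def MinimalQV (K : StructClass L) : Prop :=
  NontrivialClass K ∧ ∀ K' : StructClass L, IsQuasivariety K' → SubClass K' K →
    NontrivialClass K' → EqClass K' K

/-- A trivial class: all members have at most one element. -/
def TrivialClass (K : StructClass L) : Prop :=
  ∀ (M : Type u) [iM : L.Structure M], K M iM → Subsingleton M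

/-- The congruence of `A` generated by the pair `(a, b)`. -/
def congGen (L : FirstOrder.Language.{u, u}) (A : Type u) [iA : L.Structure A] (a b : A) : Setoid A :=
  sInf {θ : Setoid A | IsCong L A θ ∧ θ.r a b}

/-- Equationally definable principal congruences. -/
def HasEDPC (K : StructClass L) : Prop :=
  ∃ S : Finset (L.Term (Fin 4) × L.Term (Fin 4)),
    ∀ (M : Type u) [iM : L.Structure M], K M iM → ∀ a b c d : M,
      ((congGen L M a b).r c d ↔
        ∀ p ∈ S, Term.realize ![a, b, c, d] p.1 = Term.realize ![a, b, c, d] p.2)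

/-- A simple algebra: nontrivial, and its only congruences are the identity
and the total relation. -/
def IsSimpleAlg (L : FirstOrder.Language.{u, u}) (A : Type u) [iA : L.Structure A] : Prop :=
  Nontrivial A ∧ ∀ θ : Setoid A, IsCong L A θ → θ = ⊥ ∨ θ = ⊤

/-- Structural completeness: every subquasivariety generating the same variety
coincides with the class itself. -/
def IsSC (K : StructClass L) : Prop :=
  ∀ K' : StructClass L, IsQuasivariety K' → SubClass K' K →
    EqClass (VGen K') (VGen K) → EqClass K' K


/-! ### The language of De Morgan monoids -/

/-- Operation symbols for De Morgan monoids: fusion, meet, join, involution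
and the monoid identity. -/
inductive DMMOp : ℕ → Type
  | mul : DMMOp 2
  | meet : DMMOp 2
  | join : DMMOp 2
  | neg : DMMOp 1
  | e : DMMOp 0

/-- The (algebraic) language of De Morgan monoids. -/
def DMMLang : FirstOrder.Language.{0, 0} :=
  { Functions := DMMOp, Relations := fun _ => Empty }

section DMMOps

variable {B : Type} [iB : DMMLang.Structure B]

/-- Fusion. -/
def mP (a b : B) : B := funMap (L := DMMLang) DMMOp.mul ![a, b]
/-- Meet. -/
def mM (a b : B) : B := funMap (L := DMMLang) DMMOp.meet ![a, b]
/-- Join. -/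
def mJ (a b : B) : B := funMap (L := DMMLang) DMMOp.join ![a, b]
/-- Involution. -/
def mN (a : B) : B := funMap (L := DMMLang) DMMOp.neg ![a]
/-- Monoid identity. -/
def mE : B := funMap (L := DMMLang) DMMOp.e ![]
/-- Lattice order. -/
def mLe (a b : B) : Prop := mM a b = a
/-- Strict lattice order. -/
def mLt (a b : B) : Prop := mLe a b ∧ a ≠ b

end DMMOps

/-- A De Morgan monoid: a distributive lattice with a square-increasing
commutative monoid structure and an involution `¬` such that
`x·y ≤ z ↔ x·¬z ≤ ¬y`. -/
def IsDMM (B : Type) [iB : DMMLang.Structure B] : Prop :=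
  (∀ a b : B, mM a b = mM b a) ∧
  (∀ a b c : B, mM (mM a b) c = mM a (mM b c)) ∧
  (∀ a b : B, mJ a b = mJ b a) ∧
  (∀ a b c : B, mJ (mJ a b) c = mJ a (mJ b c)) ∧
  (∀ a b : B, mM a (mJ a b) = a) ∧
  (∀ a b : B, mJ a (mM a b) = a) ∧
  (∀ a b c : B, mM a (mJ b c) = mJ (mM a b) (mM a c)) ∧
  (∀ a b : B, mP a b = mP b a) ∧
  (∀ a b c : B, mP (mP a b) c = mP a (mP b c)) ∧
  (∀ a : B, mP mE a = a) ∧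
  (∀ a : B, mLe a (mP a a)) ∧
  (∀ a : B, mN (mN a) = a) ∧
  (∀ a b c : B, mLe (mP a b) c ↔ mLe (mP a (mN c)) (mN b))

/-- The two-element Boolean algebra, as a De Morgan monoid. -/
def boolStruct : DMMLang.Structure Bool where
  funMap {n} f v :=
    match f with
    | DMMOp.mul => v 0 && v 1
    | DMMOp.meet => v 0 && v 1
    | DMMOp.join => v 0 || v 1
    | DMMOp.neg => !(v 0)
    | DMMOp.e => true
  RelMap {n} r _ := False

/-- Fusion on the four-element De Morgan monoid `D₄`
(`0 = ¬(f²) < 1 = e, 2 = f < 3 = f²`, with `e, f` incomparable). -/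
def d4mul (a b : Fin 4) : Fin 4 :=
  if a = 0 ∨ b = 0 then 0 else if a = 1 then b else if b = 1 then a else 3

/-- Meet on `D₄`. -/
def d4meet (a b : Fin 4) : Fin 4 :=
  if a = b then a else if a = 0 ∨ b = 0 then 0
  else if a = 3 then b else if b = 3 then a else 0

/-- Join on `D₄`. -/
def d4join (a b : Fin 4) : Fin 4 :=
  if a = b then a else if a = 3 ∨ b = 3 then 3
  else if a = 0 then b else if b = 0 then a else 3

/-- The De Morgan monoid `D₄`. -/
def d4Struct : DMMLang.Structure (Fin 4) where
  funMap {n} f v :=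
    match f with
    | DMMOp.mul => d4mul (v 0) (v 1)
    | DMMOp.meet => d4meet (v 0) (v 1)
    | DMMOp.join => d4join (v 0) (v 1)
    | DMMOp.neg => 3 - v 0
    | DMMOp.e => 1
  RelMap {n} r _ := False

/-- An odd Sugihara monoid: an idempotent De Morgan monoid with `¬e = e`. -/
def IsOddSugihara (B : Type) [iB : DMMLang.Structure B] : Prop :=
  IsDMM B ∧ (∀ a : B, mP a a = a) ∧ mN (mE : B) = mE

/-- Membership in the variety `M`: a De Morgan monoid satisfying `e ≤ f`,
`x ≤ f²` and `f²·¬((f·x) ∧ (f·¬x)) = f²`, where `f = ¬e`. -/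
def InMclass (B : Type) [iB : DMMLang.Structure B] : Prop :=
  IsDMM B ∧
  mLe (mE : B) (mN mE) ∧
  (∀ x : B, mLe x (mP (mN mE) (mN mE))) ∧
  (∀ x : B, mP (mP (mN mE) (mN mE))
      (mN (mM (mP (mN mE) x) (mP (mN mE) (mN x)))) = mP (mN mE) (mN mE))

/-- `K` is the variety of Boolean algebras, i.e. `V(2)`. -/
def Cond1 (K : StructClass DMMLang) : Prop :=
  EqClass K (VGen (@ClassOf DMMLang Bool boolStruct))

/-- `K = V(D₄)`. -/
def Cond2 (K : StructClass DMMLang) : Prop :=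
  EqClass K (VGen (@ClassOf DMMLang (Fin 4) d4Struct))

/-- `K` consists of odd Sugihara monoids. -/
def Cond3 (K : StructClass DMMLang) : Prop :=
  ∀ (B : Type) (iB : DMMLang.Structure B), K B iB → @IsOddSugihara B iB

/-- `K` is a nontrivial subvariety of `M`. -/
def Cond4 (K : StructClass DMMLang) : Prop :=
  NontrivialClass K ∧
  ∀ (B : Type) (iB : DMMLang.Structure B), K B iB → @InMclass B iB

/-! ### De Morgan monoids as ordered algebras -/

/-- De Morgan monoids as ordered algebras: `-a` is the involution `¬a`, so that
`-1` is the constant `f`. -/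
class DeMorganMonoid (A : Type) extends DistribLattice A, CommMonoid A, InvolutiveNeg A where
  le_mul_self : ∀ a : A, a ≤ a * a
  mul_le_iff : ∀ a b c : A, a * b ≤ c ↔ a * -c ≤ -b

namespace DeMorganMonoid

section Basic

variable {A : Type} [DeMorganMonoid A]

theorem neg_le_neg_iff {a b : A} : -b ≤ -a ↔ a ≤ b := by
  rw [← one_mul a, mul_le_iff, one_mul, one_mul]

theorem neg_le_comm {a b : A} : -a ≤ b ↔ -b ≤ a := by
  rw [← neg_le_neg_iff, neg_neg]

theorem le_neg_comm {a b : A} : a ≤ -b ↔ b ≤ -a := by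
  rw [← neg_le_neg_iff, neg_neg]

theorem neg_sup (a b : A) : -(a ⊔ b) = -a ⊓ -b := by
  apply le_antisymm
  · exact le_inf (neg_le_neg_iff.2 le_sup_left) (neg_le_neg_iff.2 le_sup_right)
  · rw [le_neg_comm]
    exact sup_le (le_neg_comm.1 inf_le_left) (le_neg_comm.1 inf_le_right)

theorem neg_inf (a b : A) : -(a ⊓ b) = -a ⊔ -b := by
  rw [← neg_neg (-a ⊔ -b), neg_sup, neg_neg, neg_neg]

/-- The residual `a → b` of multiplication. -/
def res (a b : A) : A := -(a * -b)

theorem le_res_iff {a b c : A} : a ≤ res b c ↔ a * b ≤ c := by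
  rw [res, le_neg_comm, mul_comm a b]
  exact (mul_le_iff b a c).symm

theorem one_le_res_iff {a b : A} : 1 ≤ res a b ↔ a ≤ b := by
  rw [le_res_iff, one_mul]

theorem res_mul_le (a b : A) : res a b * a ≤ b := le_res_iff.1 le_rfl

instance : IsOrderedMonoid A where
  mul_le_mul_left a b h c := by
    rw [← le_res_iff]
    exact h.trans (le_res_iff.2 le_rfl)

theorem mul_sup_distrib (a b c : A) : a * (b ⊔ c) = a * b ⊔ a * c := by
  apply le_antisymm
  · rw [mul_comm, ← le_res_iff]
    apply sup_le <;> rw [le_res_iff, mul_comm]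
    exacts [le_sup_left, le_sup_right]
  · exact sup_le (mul_le_mul_right le_sup_left a) (mul_le_mul_right le_sup_right a)

theorem inf_le_mul (a b : A) : a ⊓ b ≤ a * b :=
  (le_mul_self _).trans (mul_le_mul' inf_le_left inf_le_right)

theorem mul_neg_self_le (a : A) : a * -a ≤ -1 := by
  rw [mul_le_iff, neg_neg, neg_neg, mul_one]

theorem one_le_sup_neg (a : A) : 1 ≤ a ⊔ -a := by
  rw [← neg_le_neg_iff, neg_sup, neg_neg, inf_comm]
  exact (inf_le_mul _ _).trans (mul_neg_self_le a)

theorem mul_le_neg_one_iff {a b : A} : a * b ≤ -1 ↔ a ≤ -b := by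
  rw [mul_le_iff, neg_neg, mul_one]

theorem neg_one_mul_le_neg_one_iff {a : A} : -1 * a ≤ -1 ↔ a ≤ 1 := by
  rw [mul_comm, mul_le_neg_one_iff, neg_neg]

theorem mul_self_eq_of_neg_one_le (h : (-1 : A) ≤ 1) (a : A) : a * a = a := by
  apply le_antisymm _ (le_mul_self a)
  rw [mul_le_iff]
  have h₁ : (a * -a) * a ≤ a := by
    simpa using mul_le_mul_left ((mul_neg_self_le a).trans h) a
  have h₂ := (mul_le_iff _ _ _).1 h₁
  calc a * -a ≤ a * (-a * -a) := mul_le_mul_right (le_mul_self _) a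
    _ = a * -a * -a := (mul_assoc _ _ _).symm
    _ ≤ -a := h₂

/-- Every De Morgan monoid satisfies `f³ = f²`. -/
theorem neg_one_mul_sq : (-1 * (-1 * -1) : A) = -1 * -1 := by
  apply le_antisymm _ (mul_le_mul_right (le_mul_self _) _)
  rw [mul_comm, mul_le_iff, neg_neg]
  have h : (-1 : A) * -(-1 * -1) ≤ 1 := by
    simpa [res, mul_comm] using res_mul_le (-1 : A) 1
  calc (-1 * -1 * -(-1 * -1) : A)
      ≤ -1 * -1 * (-(-1 * -1) * -(-1 * -1)) := mul_le_mul_right (le_mul_self _) _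
    _ = (-1 * -(-1 * -1)) * (-1 * -(-1 * -1)) := mul_mul_mul_comm _ _ _ _
    _ ≤ 1 * 1 := mul_le_mul' h h
    _ = 1 := mul_one 1

/-- A maximal lattice filter among those that contain `1` and avoid `d`. -/
theorem exists_filter {d : A} (hd : ¬ 1 ≤ d) :
    ∃ F : Set A, 1 ∈ F ∧ (∀ a b, a ≤ b → a ∈ F → b ∈ F) ∧ (∀ a ∈ F, ∀ b ∈ F, a ⊓ b ∈ F) ∧
      d ∉ F ∧ ∀ x ∉ F, ∃ y ∈ F, y ⊓ x ≤ d := by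
  let S : Set (Set A) := {F | 1 ∈ F ∧ (∀ a b, a ≤ b → a ∈ F → b ∈ F) ∧
    (∀ a ∈ F, ∀ b ∈ F, a ⊓ b ∈ F) ∧ d ∉ F}
  obtain ⟨F, hF, hmax⟩ := zorn_subset_nonempty S (fun c hc hchain hne => by
    refine ⟨⋃₀ c, ⟨?_, ?_, ?_, ?_⟩, fun s hs => Set.subset_sUnion_of_mem hs⟩
    · obtain ⟨s, hs⟩ := hne
      exact ⟨s, hs, (hc hs).1⟩
    · rintro a b hab ⟨s, hs, ha⟩
      exact ⟨s, hs, (hc hs).2.1 a b hab ha⟩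
    · rintro a ⟨s, hs, ha⟩ b ⟨t, ht, hb⟩
      rcases hchain.total hs ht with h | h
      · exact ⟨t, ht, (hc ht).2.2.1 a (h ha) b hb⟩
      · exact ⟨s, hs, (hc hs).2.2.1 a ha b (h hb)⟩
    · rintro ⟨s, hs, h⟩
      exact (hc hs).2.2.2 h) {x | 1 ≤ x}
    ⟨le_rfl, fun a b hab ha => le_trans ha hab, fun a ha b hb => le_inf ha hb, hd⟩
  obtain ⟨⟨h1, hup, hinf, hdF⟩, hmax⟩ := hmax
  refine ⟨F, h1, hup, hinf, hdF, fun x hx => ?_⟩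
  by_contra! hcon
  have hG : {z | ∃ y ∈ F, y ⊓ x ≤ z} ∈ S := by
    refine ⟨⟨1, h1, inf_le_left⟩, ?_, ?_, ?_⟩
    · rintro a b hab ⟨y, hy, h⟩
      exact ⟨y, hy, h.trans hab⟩
    · rintro a ⟨y, hy, h⟩ b ⟨z, hz, h'⟩
      refine ⟨y ⊓ z, hinf y hy z hz, le_inf ?_ ?_⟩
      · exact (inf_le_inf_right x inf_le_left).trans h
      · exact (inf_le_inf_right x inf_le_right).trans h'
    · rintro ⟨y, hy, h⟩
      exact hcon y hy h
  exact hx (hmax hG (fun y hy => ⟨y, hy, inf_le_left⟩) ⟨1, h1, inf_le_right⟩)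

end Basic

section Irreducible

variable {A : Type} [DeMorganMonoid A]

theorem eq_of_forall_one_le_or {d : A} (hd : ¬ 1 ≤ d) (hs : ∀ y : A, 1 ≤ y ∨ 1 ⊓ y ≤ d)
    (x y : A) (h : 1 ≤ x ⊔ y) : 1 ≤ x ∨ 1 ≤ y := by
  by_contra! hc
  apply hd
  rw [← inf_eq_left.2 h, inf_sup_left]
  exact sup_le ((hs x).resolve_left hc.1) ((hs y).resolve_left hc.2)

/-- The biconditional `(a → b) ∧ (b → a)`. -/
def bires (a b : A) : A := res a b ⊓ res b a

theorem one_le_bires_iff {a b : A} : 1 ≤ bires a b ↔ a = b := by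
  rw [bires, le_inf_iff, one_le_res_iff, one_le_res_iff, ← le_antisymm_iff]

/-- A term with `1 ≤ isConst x` in an irreducible algebra only if `x` is one of
`e ∧ f`, `e`, `f`, `e ∨ f`. -/
def isConst (x : A) : A :=
  (bires x (1 ⊓ -1) ⊔ bires x 1) ⊔ (bires x (-1) ⊔ bires x (1 ⊔ -1))

theorem eq_const_of_one_le_isConst (hp : ∀ x y : A, 1 ≤ x ⊔ y → 1 ≤ x ∨ 1 ≤ y) {x : A}
    (hx : 1 ≤ isConst x) : x = 1 ⊓ -1 ∨ x = 1 ∨ x = -1 ∨ x = 1 ⊔ -1 := by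
  simp only [← one_le_bires_iff (a := x)]
  rcases hp _ _ hx with h | h <;> rcases hp _ _ h with h | h <;> simp [h]

theorem not_one_le_of_bot [Nontrivial A] {d : A} (hd : ∀ x, d ≤ x) : ¬ 1 ≤ d := by
  intro h
  have h2 : ∀ x : A, x = 1 := fun x => by
    refine le_antisymm ?_ (h.trans (hd x))
    rw [← one_mul x, ← le_res_iff]
    exact h.trans (hd _)
  obtain ⟨x, y, hxy⟩ := exists_pair_ne A
  exact hxy ((h2 x).trans (h2 y).symm)

end Irreducible

section Bounded

variable {A : Type} [DeMorganMonoid A]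

theorem bot_le (htop : ∀ x : A, x ≤ -1 * -1) (x : A) : -(-1 * -1) ≤ x :=
  neg_le_comm.1 (htop _)

theorem bot_mul (htop : ∀ x : A, x ≤ -1 * -1) (x : A) : -(-1 * -1) * x = -(-1 * -1) :=
  le_antisymm (le_res_iff.1 (bot_le htop _)) (bot_le htop _)

theorem top_mul_top (htop : ∀ x : A, x ≤ -1 * -1) : (-1 * -1 : A) * (-1 * -1) = -1 * -1 :=
  le_antisymm (htop _) (le_mul_self _)

theorem not_one_le_bot [Nontrivial A] (htop : ∀ x : A, x ≤ -1 * -1) :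
    ¬ (1 : A) ≤ -(-1 * -1) :=
  not_one_le_of_bot (bot_le htop)

/-- If `1` is join-prime then the algebra is rigorously compact. -/
theorem eq_bot_of_top_mul_ne (hp : ∀ x y : A, 1 ≤ x ⊔ y → 1 ≤ x ∨ 1 ≤ y)
    (htop : ∀ x : A, x ≤ -1 * -1) {w : A} (hw : -1 * -1 * w ≠ -1 * -1) :
    w = -(-1 * -1) := by
  refine le_antisymm ?_ (bot_le htop w)
  have hw' : w ≤ -1 * -1 * w := by simpa using mul_le_mul_left (htop 1) w
  refine hw'.trans ?_
  rcases hp _ _ (one_le_sup_neg (-1 * -1 * w)) with h | h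
  · refine (hw (le_antisymm (htop _) ?_)).elim
    calc (-1 * -1 : A) = -1 * -1 * 1 := (mul_one _).symm
      _ ≤ -1 * -1 * (-1 * -1 * w) := mul_le_mul_right h _
      _ = -1 * -1 * w := by rw [← mul_assoc, top_mul_top htop]
  · rw [← mul_le_neg_one_iff, mul_comm, ← mul_assoc, top_mul_top htop]
    exact le_neg_comm.1 h

variable (htop : ∀ x : A, x ≤ -1 * -1) (hs : ∀ y : A, 1 ≤ y ∨ 1 ⊓ y ≤ -(-1 * -1))
include htop hs

theorem eq_one_of_neg_one_mul_ne_top {x : A} (hx : 1 ≤ x) (h : -1 * x ≠ -1 * -1) : x = 1 := by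
  refine le_antisymm ?_ hx
  rw [← neg_one_mul_le_neg_one_iff]
  rcases hs (-(-1 * x)) with h' | h'
  · exact le_neg_comm.1 h'
  · refine (h (le_antisymm (htop _) ?_)).elim
    rw [inf_eq_right.2] at h'
    · exact neg_le_neg_iff.1 h'
    · rw [neg_le_comm]
      simpa using mul_le_mul_right hx (-1)

variable [Nontrivial A] (hef : (1 : A) ≤ -1) (hN : ∀ x : A, -1 * x = -1 * -1 → -1 * -x ≠ -1 * -1)
include hef hN

theorem eq_bot_or_sup_one_eq {x : A} (hx : ¬ 1 ≤ x) :
    x = -(-1 * -1) ∨ x ⊔ 1 = -1 := by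
  have hx1 := (hs x).resolve_left hx
  have hp := eq_of_forall_one_le_or (not_one_le_bot htop) hs
  have hnx := (hp _ _ (one_le_sup_neg x)).resolve_left hx
  by_cases hu : -1 * (x ⊔ 1) = -1 * -1
  · right
    have h1 : 1 ≤ -(x ⊔ 1) := by
      rw [neg_sup]
      exact le_inf hnx hef
    rw [← neg_neg (x ⊔ 1), eq_one_of_neg_one_mul_ne_top htop hs h1 (hN _ hu)]
  · left
    have := eq_one_of_neg_one_mul_ne_top htop hs le_sup_right hu
    rw [inf_eq_right.2 (sup_eq_right.1 this)] at hx1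
    exact le_antisymm hx1 (bot_le htop x)

theorem eq_bot_of_neg_one_mul_ne_top {x : A} (hx : ¬ 1 ≤ x) (h : -1 * x ≠ -1 * -1) :
    x = -(-1 * -1) := by
  by_contra hne
  have hp := eq_of_forall_one_le_or (not_one_le_bot htop) hs
  have hx1 := (hs x).resolve_left hx
  have hu := (eq_bot_or_sup_one_eq htop hs hef hN hx).resolve_left hne
  have hnle : ¬ x ≤ 1 := fun hle => hne <| by
    rw [inf_eq_right.2 hle] at hx1
    exact le_antisymm hx1 (bot_le htop x)
  have hz : -1 * x = x * x := by
    conv_lhs => rw [← hu, mul_comm, mul_sup_distrib, mul_one]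
    exact sup_eq_left.2 (le_mul_self x)
  have hz1 : ¬ 1 ≤ -(-1 * x) := fun h1 =>
    hnle (neg_one_mul_le_neg_one_iff.1 (le_neg_comm.1 h1))
  have hz2 := (hp _ _ (one_le_sup_neg (-1 * x))).resolve_right hz1
  by_cases hfz : -1 * (-1 * x) = -1 * -1
  · rcases eq_bot_or_sup_one_eq htop hs hef hN hz1 with h1 | h1
    · exact h (neg_injective h1)
    · have hxz : -(-1 * x) = x := by
        refine eq_of_inf_eq_sup_eq (a := 1) ?_ ?_
        · rw [inf_comm, inf_comm x]
          exact le_antisymm (((hs _).resolve_left hz1).trans (bot_le htop _))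
            (hx1.trans (bot_le htop _))
        · rw [h1, hu]
      have h2 : x ≤ -x := by
        conv_rhs => rw [← hxz, neg_neg, hz]
        exact le_mul_self x
      have h3 : x ≤ -(x ⊔ 1) := by
        rw [neg_sup]
        exact le_inf h2 (hu ▸ le_sup_left)
      rw [hu, neg_neg] at h3
      exact hnle h3
  · have := eq_one_of_neg_one_mul_ne_top htop hs hz2 hfz
    rw [hz] at this
    exact hnle (this ▸ le_mul_self x)

/-- A simple member of the variety `M` has no elements besides `¬(f²)`, `e`, `f` and `f²`. -/
theorem eq_const_of_simple (x : A) :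
    x = -(-1 * -1) ∨ x = 1 ∨ x = -1 ∨ x = -1 * -1 := by
  have key : ∀ y : A, -1 * y ≠ -1 * -1 → y = -(-1 * -1) ∨ y = 1 := fun y hy => by
    by_cases h1 : 1 ≤ y
    · exact .inr (eq_one_of_neg_one_mul_ne_top htop hs h1 hy)
    · exact .inl (eq_bot_of_neg_one_mul_ne_top htop hs hef hN h1 hy)
  by_cases h : -1 * x = -1 * -1
  · rcases key (-x) (hN x h) with h | h
    · exact .inr (.inr (.inr (neg_injective h)))
    · exact .inr (.inr (.inl (by rw [← h, neg_neg])))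
  · rcases key x h with h | h <;> simp [h]

end Bounded

end DeMorganMonoid

/-! ### De Morgan monoids as structures -/

section Bridge

instance DeMorganMonoid.ofIsDMM (B : Type) [DMMLang.Structure B] [h : Fact (IsDMM B)] :
    DeMorganMonoid B where
  mul := mP
  one := mE
  neg := mN
  inf := mM
  sup := mJ
  le := mLe
  le_refl a := by
    obtain ⟨-, -, -, -, h5, h6, -⟩ := h.out
    change mM a a = a
    conv_lhs => rw [← h6 a a, h6 a a]
    conv_lhs => arg 2; rw [← h6 a a]
    exact h5 a _
  le_trans a b c hab hbc := by
    obtain ⟨-, h2, -⟩ := h.out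
    change mM a c = a
    rw [← show mM a b = a from hab, h2, show mM b c = b from hbc]
  le_antisymm a b hab hba := by
    obtain ⟨h1, -⟩ := h.out
    rw [← show mM a b = a from hab, h1, show mM b a = b from hba]
  inf_le_left a b := by
    obtain ⟨h1, h2, -, -, h5, h6, -⟩ := h.out
    have hid : mM a a = a := by
      conv_lhs => arg 2; rw [← h6 a a]
      exact h5 a _
    change mM (mM a b) a = mM a b
    rw [h1, ← h2, hid]
  inf_le_right a b := by
    obtain ⟨h1, h2, -, -, h5, h6, -⟩ := h.out
    have hid : mM b b = b := by
      conv_lhs => arg 2; rw [← h6 b b]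
      exact h5 b _
    change mM (mM a b) b = mM a b
    rw [h2, hid]
  le_inf a b c hab hac := by
    obtain ⟨-, h2, -⟩ := h.out
    change mM a (mM b c) = a
    rw [← h2, show mM a b = a from hab, show mM a c = a from hac]
  le_sup_left a b := h.out.2.2.2.2.1 a b
  le_sup_right a b := by
    obtain ⟨-, -, h3, -, h5, -⟩ := h.out
    change mM b (mJ a b) = b
    rw [h3, h5]
  sup_le a b c hac hbc := by
    obtain ⟨h1, -, -, -, -, -, h7, -⟩ := h.out
    change mM (mJ a b) c = mJ a b
    rw [h1, h7, h1 c a, h1 c b, show mM a c = a from hac, show mM b c = b from hbc]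
  le_sup_inf a b c := by
    obtain ⟨h1, h2, h3, h4, h5, h6, h7, -⟩ := h.out
    have hid : ∀ x : B, mM x x = x := fun x => by
      conv_lhs => arg 2; rw [← h6 x x]
      exact h5 x _
    have : mM (mJ a b) (mJ a c) = mJ a (mM b c) := by
      rw [h7, h1 _ a, h5, h1 _ c, h7, ← h4, h1 c a, h6, h1 c b]
    change mM (mM (mJ a b) (mJ a c)) (mJ a (mM b c)) = mM (mJ a b) (mJ a c)
    rw [this, hid]
  mul_comm := h.out.2.2.2.2.2.2.2.1
  mul_assoc := h.out.2.2.2.2.2.2.2.2.1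
  one_mul := h.out.2.2.2.2.2.2.2.2.2.1
  mul_one a := by
    obtain ⟨-, -, -, -, -, -, -, h8, -, h10, -⟩ := h.out
    exact (h8 a mE).trans (h10 a)
  le_mul_self := h.out.2.2.2.2.2.2.2.2.2.2.1
  neg_neg := h.out.2.2.2.2.2.2.2.2.2.2.2.1
  mul_le_iff := h.out.2.2.2.2.2.2.2.2.2.2.2.2

/-- A map preserving the five operations is a homomorphism. -/
def mkHom {A B : Type} [DMMLang.Structure A] [DMMLang.Structure B] (h : A → B)
    (hP : ∀ a b, h (mP a b) = mP (h a) (h b)) (hM : ∀ a b, h (mM a b) = mM (h a) (h b))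
    (hJ : ∀ a b, h (mJ a b) = mJ (h a) (h b)) (hN : ∀ a, h (mN a) = mN (h a))
    (hE : h mE = mE) : A →[DMMLang] B where
  toFun := h
  map_fun' {n} f x := by
    have e1 : ∀ y : Fin 1 → A, y = ![y 0] := fun y => by ext i; fin_cases i; rfl
    have e2 : ∀ y : Fin 2 → A, y = ![y 0, y 1] := fun y => by ext i; fin_cases i <;> rfl
    have c1 : ∀ a, h ∘ ![a] = ![h a] := fun a => by ext i; fin_cases i; rfl
    have c2 : ∀ a b, h ∘ ![a, b] = ![h a, h b] := fun a b => by ext i; fin_cases i <;> rfl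
    cases f with
    | mul => rw [e2 x, c2]; exact hP _ _
    | meet => rw [e2 x, c2]; exact hM _ _
    | join => rw [e2 x, c2]; exact hJ _ _
    | neg => rw [e1 x, c1]; exact hN _
    | e =>
      rw [Subsingleton.elim x ![], Subsingleton.elim (h ∘ ![]) ![] ]
      exact hE
  map_rel' r := r.elim

section HomLemmas

variable {A B : Type} [DMMLang.Structure A] [DMMLang.Structure B] (h : A →[DMMLang] B)

theorem hom_mP (a b : A) : h (mP a b) = mP (h a) (h b) := by
  refine (h.map_fun _ _).trans (congrArg _ ?_)
  ext i; fin_cases i <;> rfl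

theorem hom_mM (a b : A) : h (mM a b) = mM (h a) (h b) := by
  refine (h.map_fun _ _).trans (congrArg _ ?_)
  ext i; fin_cases i <;> rfl

theorem hom_mJ (a b : A) : h (mJ a b) = mJ (h a) (h b) := by
  refine (h.map_fun _ _).trans (congrArg _ ?_)
  ext i; fin_cases i <;> rfl

theorem hom_mN (a : A) : h (mN a) = mN (h a) := by
  refine (h.map_fun _ _).trans (congrArg _ ?_)
  ext i; fin_cases i; rfl

theorem hom_mE : h mE = mE :=
  (h.map_fun _ _).trans (congrArg _ (Subsingleton.elim _ _))

variable [Fact (IsDMM A)] [Fact (IsDMM B)]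

theorem hom_mul (a b : A) : h (a * b) = h a * h b := hom_mP h a b
theorem hom_inf (a b : A) : h (a ⊓ b) = h a ⊓ h b := hom_mM h a b
theorem hom_neg (a : A) : h (-a) = -h a := hom_mN h a
theorem hom_one : h 1 = 1 := hom_mE h

theorem hom_mono {a b : A} (hab : a ≤ b) : h a ≤ h b := by
  rw [← inf_eq_left] at hab ⊢
  rw [← hom_inf, hab]

end HomLemmas

/-- A bijective homomorphism of algebras is an isomorphism. -/
noncomputable def equivOfBijective {A B : Type} [DMMLang.Structure A] [DMMLang.Structure B]
    (h : A →[DMMLang] B) (hh : Function.Bijective h) : A ≃[DMMLang] B where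
  toEquiv := Equiv.ofBijective h hh
  map_fun' f x := h.map_fun f x
  map_rel' r := r.elim

/-- An injective homomorphism of algebras is an embedding. -/
def embeddingOfInjective {A B : Type} [DMMLang.Structure A] [DMMLang.Structure B]
    (h : A →[DMMLang] B) (hh : Function.Injective h) : A ↪[DMMLang] B where
  toFun := h
  inj' := hh
  map_fun' f x := h.map_fun f x
  map_rel' r := r.elim

end Bridge

/-! ### Existential positive sentences and equations -/

theorem IsEP.realize_hom {A B : Type u} [L.Structure A] [L.Structure B] (h : A →[L] B) {n : ℕ}
    {φ : L.BoundedFormula Empty n} (hφ : IsEP φ) (v : Empty → A) (xs : Fin n → A)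
    (H : φ.Realize v xs) : φ.Realize (h ∘ v) (h ∘ xs) := by
  have hsum : ∀ {k : ℕ} (ys : Fin k → A), Sum.elim (h ∘ v) (h ∘ ys) = h ∘ Sum.elim v ys :=
    fun ys => (Sum.comp_elim h v ys).symm
  induction hφ with
  | equal t₁ t₂ =>
    rw [BoundedFormula.realize_bdEqual] at H ⊢
    rw [hsum, HomClass.realize_term, HomClass.realize_term, H]
  | rel R ts =>
    change RelMap R _
    have := h.map_rel R _ H
    convert this using 2
    rw [hsum, HomClass.realize_term]
    rfl
  | sup _ _ ih₁ ih₂ =>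
    rw [BoundedFormula.realize_sup] at H ⊢
    exact H.imp (ih₁ _) (ih₂ _)
  | inf _ _ ih₁ ih₂ =>
    rw [BoundedFormula.realize_inf] at H ⊢
    exact H.imp (ih₁ _) (ih₂ _)
  | ex _ ih =>
    rw [BoundedFormula.realize_ex] at H ⊢
    obtain ⟨a, ha⟩ := H
    refine ⟨h a, ?_⟩
    have := ih _ ha
    rwa [Fin.comp_snoc] at this

theorem IsEP.sentence_hom {A B : Type u} [L.Structure A] [L.Structure B] (h : A →[L] B)
    {φ : L.Sentence} (hφ : IsEP φ) (H : A ⊨ φ) : B ⊨ φ := by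
  have := hφ.realize_hom h _ _ H
  rwa [Subsingleton.elim (h ∘ default) default, Subsingleton.elim (h ∘ default) default] at this

/-- In a passively structurally complete class, solvability of an equation in one unknown
transfers between nontrivial members. -/
theorem IsPSC.exists_realize_eq {K : StructClass L} (hK : IsPSC K) {A B : Type u}
    [iA : L.Structure A] [iB : L.Structure B] (hA : K A iA) (hB : K B iB) [hnA : Nontrivial A]
    [hnB : Nontrivial B] (s t : L.Term (Empty ⊕ Fin 1))
    (h : ∃ x : A, s.realize (fun _ => x) = t.realize (fun _ => x)) :
    ∃ x : B, s.realize (fun _ => x) = t.realize (fun _ => x) := by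
  have key : ∀ (C : Type u) [L.Structure C], C ⊨ (s.bdEqual t).ex ↔
      ∃ x : C, s.realize (fun _ => x) = t.realize (fun _ => x) := fun C _ => by
    rw [Sentence.Realize, Formula.Realize, BoundedFormula.realize_ex]
    have : ∀ x : C, Sum.elim (default : Empty → C) (Fin.snoc default x : Fin 1 → C) =
        fun _ => x := fun x => by
      ext i
      rcases i with i | i
      · exact i.elim
      · fin_cases i; rfl
    simp only [BoundedFormula.realize_bdEqual, this]
  rw [← key] at h ⊢
  exact hK A B hA hB hnA hnB _ (.ex (.equal s t)) h

theorem isVariety_setOf_eq {α : Type} (s t : L.Term α) :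
    IsVariety (fun M (_ : L.Structure M) => ∀ v : α → M, s.realize v = t.realize v) where
  iso_closed M _ N _ h H v := by
    obtain ⟨g⟩ := h
    have e : v = g ∘ (g.symm ∘ v) := by ext i; simp
    rw [e, HomClass.realize_term (t := s), HomClass.realize_term (t := t), H]
  hom_closed M _ N _ h H v := by
    obtain ⟨g, hg⟩ := h
    have e : v = g ∘ fun i => Function.surjInv hg (v i) := by
      ext i; exact (Function.surjInv_eq hg _).symm
    rw [e, HomClass.realize_term (t := s), HomClass.realize_term (t := t), H]
  sub_closed M _ N _ h H v := by
    obtain ⟨g⟩ := h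
    apply g.injective
    rw [← HomClass.realize_term, ← HomClass.realize_term, H]
  prod_closed ι M iM H v := by
    let _ := piStructure (L := L) M
    funext i
    let p : (∀ i, M i) →[L] M i :=
      { toFun := fun x => x i
        map_fun' := fun _ _ => rfl
        map_rel' := fun _ _ h => h i }
    change p _ = p _
    rw [← HomClass.realize_term, ← HomClass.realize_term, H]

/-- Equations valid in `T` hold in the variety generated by `T`. -/
theorem VGen.realize_eq {T : Type u} [L.Structure T] {α : Type} (s t : L.Term α)
    (hT : ∀ v : α → T, s.realize v = t.realize v) {M : Type u} [iM : L.Structure M]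
    (hM : VGen (ClassOf T) M iM) (v : α → M) : s.realize v = t.realize v :=
  hM _ (isVariety_setOf_eq s t) (fun N _ ⟨g⟩ =>
    (isVariety_setOf_eq s t).iso_closed T N ⟨g.symm⟩ hT) v

theorem VGen.self (T : Type u) [iT : L.Structure T] : VGen (ClassOf T) T iT :=
  fun _ _ h => h T iT ⟨Language.Equiv.refl L T⟩

/-- A class is generated by its member `T` when homomorphisms into `T` separate points. -/
theorem eqClass_vGen {K : StructClass L} [L.IsAlgebraic] (hK : IsVariety K) {T : Type u}
    [iT : L.Structure T] (hT : K T iT)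
    (hsep : ∀ (A : Type u) [iA : L.Structure A], K A iA → ∀ a b : A, a ≠ b →
      ∃ h : A →[L] T, h a ≠ h b) : EqClass K (VGen (ClassOf T)) := by
  refine fun A iA => ⟨fun hA K' hK' hTK' => ?_, fun hA => hA K hK fun M iM ⟨g⟩ =>
    hK.iso_closed T M ⟨g.symm⟩ hT⟩
  let _ := piStructure (L := L) fun _ : (A →[L] T) => T
  have hP := hK'.prod_closed (A →[L] T) (fun _ => T) fun _ =>
    hTK' T iT ⟨Language.Equiv.refl L T⟩
  refine hK'.sub_closed A (∀ _ : A →[L] T, T) ⟨?_⟩ hP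
  exact
    { toFun := fun a h => h a
      inj' := fun a b hab => by
        by_contra hne
        obtain ⟨h, hh⟩ := hsep A hA a b hne
        exact hh (congrFun hab h)
      map_fun' := fun f x => funext fun h => h.map_fun f x
      map_rel' := fun r => isEmptyElim r }

/-! ### Quotients by filters -/

section Quotients

open DeMorganMonoid

variable {A : Type} [DeMorganMonoid A] {F : Set A}

theorem DeMorganMonoid.mul_mem_of_filter (hup : ∀ a b, a ≤ b → a ∈ F → b ∈ F)
    (hinf : ∀ a ∈ F, ∀ b ∈ F, a ⊓ b ∈ F) {a b : A} (ha : a ∈ F) (hb : b ∈ F) : a * b ∈ F :=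
  hup _ _ (inf_le_mul a b) (hinf a ha b hb)

theorem DeMorganMonoid.bires_mem_iff (hup : ∀ a b, a ≤ b → a ∈ F → b ∈ F)
    (hinf : ∀ a ∈ F, ∀ b ∈ F, a ⊓ b ∈ F) {a b : A} :
    bires a b ∈ F ↔ res a b ∈ F ∧ res b a ∈ F :=
  ⟨fun h => ⟨hup _ _ inf_le_left h, hup _ _ inf_le_right h⟩, fun h => hinf _ h.1 _ h.2⟩

/-- The congruence determined by a filter that contains the identity. -/
def DeMorganMonoid.filterSetoid (h1 : (1 : A) ∈ F) (hup : ∀ a b, a ≤ b → a ∈ F → b ∈ F)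
    (hinf : ∀ a ∈ F, ∀ b ∈ F, a ⊓ b ∈ F) : Setoid A where
  r a b := bires a b ∈ F
  iseqv :=
    { refl := fun a => hup _ _ (one_le_bires_iff.2 rfl) h1
      symm := fun {a b} h => by rwa [bires, inf_comm] at h
      trans := fun {a b c} h h' => by
        rw [bires_mem_iff hup hinf] at h h' ⊢
        have key : ∀ {a b c : A}, res a b ∈ F → res b c ∈ F → res a c ∈ F := fun {a b c} h h' =>
          hup _ _ (by
            rw [le_res_iff, mul_assoc]
            exact (mul_le_mul_right (res_mul_le a b) _).trans (res_mul_le b c))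
            (mul_mem_of_filter hup hinf h' h)
        exact ⟨key h.1 h'.1, key h'.2 h.2⟩ }

end Quotients

section VarietyQuotients

open DeMorganMonoid

variable {A : Type} [iA : DMMLang.Structure A] [Fact (IsDMM A)] {F : Set A}

theorem isCong_filterSetoid (h1 : (1 : A) ∈ F) (hup : ∀ a b, a ≤ b → a ∈ F → b ∈ F)
    (hinf : ∀ a ∈ F, ∀ b ∈ F, a ⊓ b ∈ F) : IsCong DMMLang A (filterSetoid h1 hup hinf) := by
  refine ⟨fun n f x y hxy => ?_, fun n r => r.elim⟩
  change ∀ i, bires (x i) (y i) ∈ F at hxy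
  change bires (funMap f x) (funMap f y) ∈ F
  simp only [bires_mem_iff hup hinf] at hxy ⊢
  suffices key : ∀ x y : Fin n → A, (∀ i, res (x i) (y i) ∈ F) → (∀ i, res (y i) (x i) ∈ F) →
      res (funMap f x) (funMap f y) ∈ F from
    ⟨key x y (fun i => (hxy i).1) fun i => (hxy i).2,
      key y x (fun i => (hxy i).2) fun i => (hxy i).1⟩
  clear hxy x y
  intro x y hxy hyx
  have e1 : ∀ z : Fin 1 → A, z = ![z 0] := fun z => by ext i; fin_cases i; rfl
  have e2 : ∀ z : Fin 2 → A, z = ![z 0, z 1] := fun z => by ext i; fin_cases i <;> rfl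
  cases f with
  | mul =>
    rw [e2 x, e2 y]
    change res (x 0 * x 1) (y 0 * y 1) ∈ F
    refine hup _ _ ?_ (mul_mem_of_filter hup hinf (hxy 0) (hxy 1))
    rw [le_res_iff, mul_mul_mul_comm]
    exact mul_le_mul' (res_mul_le _ _) (res_mul_le _ _)
  | meet =>
    rw [e2 x, e2 y]
    change res (x 0 ⊓ x 1) (y 0 ⊓ y 1) ∈ F
    refine hup _ _ ?_ (hinf _ (hxy 0) _ (hxy 1))
    rw [le_res_iff]
    exact le_inf ((mul_le_mul' inf_le_left inf_le_left).trans (res_mul_le _ _))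
      ((mul_le_mul' inf_le_right inf_le_right).trans (res_mul_le _ _))
  | join =>
    rw [e2 x, e2 y]
    change res (x 0 ⊔ x 1) (y 0 ⊔ y 1) ∈ F
    refine hup _ _ ?_ (hinf _ (hxy 0) _ (hxy 1))
    rw [le_res_iff, mul_sup_distrib]
    exact sup_le_sup ((mul_le_mul_left inf_le_left _).trans (res_mul_le _ _))
      ((mul_le_mul_left inf_le_right _).trans (res_mul_le _ _))
  | neg =>
    rw [e1 x, e1 y]
    change res (-x 0) (-y 0) ∈ F
    have : res (-x 0) (-y 0) = res (y 0) (x 0) := by rw [res, res, neg_neg, mul_comm]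
    rw [this]
    exact hyx 0
  | e =>
    rw [Subsingleton.elim x y]
    exact hup _ _ (one_le_res_iff.2 le_rfl) h1

variable {K : StructClass DMMLang} (hK : IsVariety K)
  (hdmm : ∀ (B : Type) (iB : DMMLang.Structure B), K B iB → @IsDMM B iB)
include hK hdmm

theorem exists_quotient (hA : K A iA) (h1 : (1 : A) ∈ F) (hup : ∀ a b, a ≤ b → a ∈ F → b ∈ F)
    (hinf : ∀ a ∈ F, ∀ b ∈ F, a ⊓ b ∈ F) :
    ∃ (B : Type) (iB : DMMLang.Structure B) (_ : Fact (IsDMM B)) (h : A →[DMMLang] B),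
      K B iB ∧ Function.Surjective h ∧ ∀ x, 1 ≤ h x ↔ x ∈ F := by
  have hc := isCong_filterSetoid h1 hup hinf
  let iB := quotStructure DMMLang A _ hc
  let h : A →[DMMLang] Quotient (filterSetoid h1 hup hinf) :=
    { toFun := Quotient.mk _
      map_fun' := fun f x => (@funMap_quotient_mk' DMMLang A (filterSetoid h1 hup hinf)
        (congPrestructure DMMLang A _ hc) _ f x).symm
      map_rel' := fun r => r.elim }
  have hB := hK.hom_closed A (Quotient (filterSetoid h1 hup hinf))
    ⟨h, Quotient.mk_surjective⟩ hA
  have hF : Fact (IsDMM (Quotient (filterSetoid h1 hup hinf))) := ⟨hdmm _ iB hB⟩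
  refine ⟨_, iB, hF, h, hB, Quotient.mk_surjective, fun x => ?_⟩
  rw [← inf_eq_left, ← hom_one h, ← hom_inf]
  have : h (1 ⊓ x) = h 1 ↔ bires (1 ⊓ x) 1 ∈ F := Quotient.eq
  rw [this, bires_mem_iff hup hinf]
  have e : res 1 (1 ⊓ x) = 1 ⊓ x := by rw [res, one_mul, neg_neg]
  rw [e]
  exact ⟨fun h => hup _ _ inf_le_right h.2, fun h =>
    ⟨hup _ _ (one_le_res_iff.2 inf_le_left) h1, hinf _ h1 _ h⟩⟩

/-- The quotient by the principal filter generated by `g ≤ 1`. -/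
theorem exists_principal_quotient (hA : K A iA) {g : A} (hg : g ≤ 1) :
    ∃ (B : Type) (iB : DMMLang.Structure B) (_ : Fact (IsDMM B)) (h : A →[DMMLang] B),
      K B iB ∧ Function.Surjective h ∧ ∀ x, 1 ≤ h x ↔ g ≤ x :=
  exists_quotient (F := {x | g ≤ x}) hK hdmm hA hg (fun _ _ hab ha => le_trans ha hab)
    fun _ ha _ hb => le_inf (α := A) ha hb

/-- A quotient in which `1` is not below `d`, but every element not above `1` meets `1`
below `d`. -/
theorem exists_maximal_quotient (hA : K A iA) {d : A} (hd : ¬ 1 ≤ d) :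
    ∃ (B : Type) (iB : DMMLang.Structure B) (_ : Fact (IsDMM B)) (h : A →[DMMLang] B),
      K B iB ∧ ¬ 1 ≤ h d ∧ Nontrivial B ∧ ∀ y : B, 1 ≤ y ∨ 1 ⊓ y ≤ h d := by
  obtain ⟨F, h1, hup, hinf, hdF, hmax⟩ := exists_filter hd
  obtain ⟨B, iB, hB, h, hKB, hsurj, hF⟩ := exists_quotient hK hdmm hA h1 hup hinf
  refine ⟨B, iB, hB, h, hKB, fun h' => hdF ((hF d).1 h'), ?_, fun y => ?_⟩
  · refine ⟨h d, 1, fun h' => hdF ((hF d).1 h'.ge)⟩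
  · obtain ⟨x, rfl⟩ := hsurj y
    by_cases hx : x ∈ F
    · exact .inl ((hF x).2 hx)
    · obtain ⟨y, hy, hyx⟩ := hmax x hx
      exact .inr ((inf_le_inf_right _ ((hF y).2 hy)).trans (hom_inf h y x ▸ hom_mono h hyx))

end VarietyQuotients

/-! ### The algebras `2`, `D₄` and `C₄` -/

attribute [local instance] boolStruct d4Struct

/-- The underlying set of the four-element chain `C₄`. -/
def C4 : Type := Fin 4

instance : Fintype C4 := inferInstanceAs (Fintype (Fin 4))
instance : DecidableEq C4 := inferInstanceAs (DecidableEq (Fin 4))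
instance : Nontrivial C4 := inferInstanceAs (Nontrivial (Fin 4))

/-- Involution on `C₄`. -/
def c4neg (a : Fin 4) : Fin 4 := 3 - a

/-- The De Morgan monoid `C₄`: the chain `¬(f²) < e < f < f²`. -/
instance c4Struct : DMMLang.Structure C4 where
  funMap f v :=
    match f with
    | DMMOp.mul => d4mul (v 0) (v 1)
    | DMMOp.meet => min (α := Fin 4) (v 0) (v 1)
    | DMMOp.join => max (α := Fin 4) (v 0) (v 1)
    | DMMOp.neg => c4neg (v 0)
    | DMMOp.e => (1 : Fin 4)
  RelMap _ _ := False

section SmallAlgebras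

open DeMorganMonoid

/-- The candidate interpretation of `C₄` or `D₄` in a De Morgan monoid. -/
def four (A : Type) [DeMorganMonoid A] : Fin 4 → A :=
  ![-(-1 * -1), 1, -1, -1 * -1]

section Four

variable {A : Type} [DeMorganMonoid A]

theorem four_neg (a : Fin 4) : four A (3 - a) = -four A a := by
  fin_cases a <;> simp [four]

theorem four_surjective (hc : ∀ x : A, x = -(-1 * -1) ∨ x = 1 ∨ x = -1 ∨ x = -1 * -1) :
    Function.Surjective (four A) := fun x => by
  rcases hc x with rfl | rfl | rfl | rfl
  exacts [⟨0, rfl⟩, ⟨1, rfl⟩, ⟨2, rfl⟩, ⟨3, rfl⟩]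

variable (htop : ∀ x : A, x ≤ -1 * -1)
include htop

theorem four_mul (a b : Fin 4) : four A (d4mul a b) = four A a * four A b := by
  have h1 := neg_one_mul_sq (A := A)
  have h2 := top_mul_top htop
  have h3 := bot_mul htop
  have h4 : ∀ x : A, x * -(-1 * -1) = -(-1 * -1) := fun x => by rw [mul_comm, h3]
  have h5 : (-1 * -1 * -1 : A) = -1 * -1 := by rw [mul_comm, h1]
  fin_cases a <;> fin_cases b <;> simp [four, d4mul, h1, h2, h3, h4, h5]

theorem four_injective [Nontrivial A] : Function.Injective (four A) := by
  have h0 := not_one_le_bot htop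
  have h01 : (1 : A) ≠ -(-1 * -1) := fun h => h0 h.le
  have h32 : (-1 : A) ≠ -1 * -1 := fun h => h01 (by rw [← h, neg_neg])
  have h12 : (1 : A) ≠ -1 := fun h => h01 (by rw [← h, one_mul, ← h])
  have h03 : (-(-1 * -1) : A) ≠ -1 * -1 := fun h => h0 (by rw [h]; exact htop 1)
  have h02 : (-1 : A) ≠ -(-1 * -1) := fun h => h0 (by
    have h' : (1 : A) = -1 * -1 := neg_injective h
    have h2 := bot_mul htop (-(-1 * -1))
    rw [← h, ← h'] at h2
    rw [← h, ← h2])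
  have h13 : (1 : A) ≠ -1 * -1 := fun h => h02 (by rw [← h])
  intro a b hab
  fin_cases a <;> fin_cases b <;> first | rfl | (exfalso; revert hab)
  exacts [h01.symm, h02.symm, h03, h01, h12, h13, h02, h12.symm, h32, h03.symm, h13.symm, h32.symm]

end Four

variable {A : Type} [DMMLang.Structure A] [Fact (IsDMM A)]

/-- The homomorphism from `C₄`. -/
def c4Hom (htop : ∀ x : A, x ≤ -1 * -1) (hef : (1 : A) ≤ -1) : C4 →[DMMLang] A :=
  have hmono : Monotone (four A) := by
    refine Fin.monotone_iff_le_succ.2 fun i => ?_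
    fin_cases i
    exacts [bot_le htop _, hef, htop _]
  mkHom (A := C4) (four A) (four_mul htop) (fun a b => hmono.map_inf a b)
    (fun a b => hmono.map_sup a b) four_neg rfl

/-- The homomorphism from `D₄`. -/
def d4Hom (htop : ∀ x : A, x ≤ -1 * -1) (hef : (1 : A) ⊓ -1 = -(-1 * -1)) :
    Fin 4 →[DMMLang] A :=
  have hef' : (1 : A) ⊔ -1 = -1 * -1 := by
    rw [← neg_neg (-1 * -1 : A), ← hef, DeMorganMonoid.neg_inf, neg_neg, sup_comm]
  have h1 := fun x => inf_eq_left.2 (bot_le htop x)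
  have h2 := fun x => inf_eq_right.2 (bot_le htop x)
  have h3 := fun x => inf_eq_left.2 (htop x)
  have h4 := fun x => inf_eq_right.2 (htop x)
  have h5 := fun x => sup_eq_left.2 (bot_le htop x)
  have h6 := fun x => sup_eq_right.2 (bot_le htop x)
  have h7 := fun x => sup_eq_left.2 (htop x)
  have h8 := fun x => sup_eq_right.2 (htop x)
  have hM : ∀ a b : Fin 4, four A (d4meet a b) = four A a ⊓ four A b := fun a b => by
    fin_cases a <;> fin_cases b <;>
      simp [four, d4meet, h1, h2, h3, h4, hef, inf_comm (-1 : A) 1]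
  have hJ : ∀ a b : Fin 4, four A (d4join a b) = four A a ⊔ four A b := fun a b => by
    fin_cases a <;> fin_cases b <;>
      simp [four, d4join, h5, h6, h7, h8, hef', sup_comm (-1 : A) 1]
  mkHom (four A) (four_mul htop) hM hJ four_neg rfl

/-- The homomorphism from the two-element Boolean algebra. -/
def boolHom (hbot : ∀ x : A, -1 ≤ x) : Bool →[DMMLang] A :=
  have h1 : (-1 : A) ≤ 1 := hbot 1
  mkHom (fun b => cond b 1 (-1))
    (fun a b => by
      change cond (a && b) (1 : A) (-1) = cond a 1 (-1) * cond b 1 (-1)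
      cases a <;> cases b <;>
        simp [mul_self_eq_of_neg_one_le h1])
    (fun a b => by
      change cond (a && b) (1 : A) (-1) = cond a 1 (-1) ⊓ cond b 1 (-1)
      cases a <;> cases b <;> simp [h1])
    (fun a b => by
      change cond (a || b) (1 : A) (-1) = cond a 1 (-1) ⊔ cond b 1 (-1)
      cases a <;> cases b <;> simp [h1])
    (fun a => by
      change cond (!a) (1 : A) (-1) = -cond a 1 (-1)
      cases a <;> simp)
    rfl

theorem c4Hom_injective [Nontrivial A] (htop : ∀ x : A, x ≤ -1 * -1) (hef : (1 : A) ≤ -1) :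
    Function.Injective (c4Hom htop hef) := four_injective htop

theorem d4Hom_injective [Nontrivial A] (htop : ∀ x : A, x ≤ -1 * -1)
    (hef : (1 : A) ⊓ -1 = -(-1 * -1)) : Function.Injective (d4Hom htop hef) :=
  four_injective htop

theorem boolHom_injective [Nontrivial A] (hbot : ∀ x : A, -1 ≤ x) :
    Function.Injective (boolHom hbot) := by
  have h : (1 : A) ≠ -1 := fun h => not_one_le_of_bot hbot h.le
  intro a b hab
  cases a <;> cases b <;> first | rfl | (exfalso; revert hab)
  exacts [h.symm, h]

/-- In an irreducible algebra with least element `e ∧ f` and `f ≰ e`, the top is `f²`. -/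
theorem d4_of_irreducible (hbot : ∀ x : A, 1 ⊓ -1 ≤ x)
    (hp : ∀ x y : A, 1 ≤ x ⊔ y → 1 ≤ x ∨ 1 ≤ y) (hfe : ¬ (-1 : A) ≤ 1) :
    (∀ x : A, x ≤ -1 * -1) ∧ (1 : A) ⊓ -1 = -(-1 * -1) := by
  have h1 : (1 : A) ≤ -1 * -1 := (hp _ _ (one_le_sup_neg (-1 * -1))).resolve_right fun h =>
    hfe (neg_one_mul_le_neg_one_iff.1 (le_neg_comm.1 h))
  have htop : ∀ x : A, x ≤ -1 * -1 := fun x => by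
    refine le_trans ?_ (sup_le h1 (le_mul_self (-1)))
    rw [← DeMorganMonoid.neg_le_neg_iff, DeMorganMonoid.neg_sup, neg_neg, inf_comm]
    exact hbot _
  exact ⟨htop, le_antisymm (hbot _) (bot_le htop _)⟩

theorem boolHom_surjective (hbot : ∀ x : A, -1 ≤ x)
    (hc : ∀ x : A, x = 1 ⊓ -1 ∨ x = 1 ∨ x = -1 ∨ x = 1 ⊔ -1) :
    Function.Surjective (boolHom hbot) := fun x => by
  rw [inf_eq_right.2 (hbot 1), sup_eq_left.2 (hbot 1)] at hc
  rcases hc x with rfl | rfl | rfl | rfl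
  exacts [⟨false, rfl⟩, ⟨true, rfl⟩, ⟨false, rfl⟩, ⟨true, rfl⟩]

theorem d4Hom_surjective (htop : ∀ x : A, x ≤ -1 * -1) (hef : (1 : A) ⊓ -1 = -(-1 * -1))
    (hc : ∀ x : A, x = 1 ⊓ -1 ∨ x = 1 ∨ x = -1 ∨ x = 1 ⊔ -1) :
    Function.Surjective (d4Hom htop hef) := by
  have hef' : (1 : A) ⊔ -1 = -1 * -1 := by
    rw [← neg_neg (-1 * -1 : A), ← hef, DeMorganMonoid.neg_inf, neg_neg, sup_comm]
  rw [hef, hef'] at hc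
  exact four_surjective hc

end SmallAlgebras

/-! ### Terms -/

section Terms

variable {α : Type}

/-- Fusion of terms. -/
def tP (s t : DMMLang.Term α) : DMMLang.Term α := Functions.apply₂ (L := DMMLang) DMMOp.mul s t
/-- Meet of terms. -/
def tM (s t : DMMLang.Term α) : DMMLang.Term α := Functions.apply₂ (L := DMMLang) DMMOp.meet s t
/-- Join of terms. -/
def tJ (s t : DMMLang.Term α) : DMMLang.Term α := Functions.apply₂ (L := DMMLang) DMMOp.join s t
/-- Involution of a term. -/
def tN (s : DMMLang.Term α) : DMMLang.Term α := Functions.apply₁ (L := DMMLang) DMMOp.neg s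
/-- The identity as a term. -/
def tE : DMMLang.Term α := Term.func (L := DMMLang) DMMOp.e ![]
/-- The term `(x → y) ∧ (y → x)`. -/
def tBires (x y : DMMLang.Term α) : DMMLang.Term α :=
  tM (tN (tP x (tN y))) (tN (tP y (tN x)))
/-- The term version of `DeMorganMonoid.isConst`. -/
def tIsConst (x : DMMLang.Term α) : DMMLang.Term α :=
  tJ (tJ (tBires x (tM tE (tN tE))) (tBires x tE))
    (tJ (tBires x (tN tE)) (tBires x (tJ tE (tN tE))))

variable {B : Type} [DMMLang.Structure B] (v : α → B) (s t : DMMLang.Term α)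

@[simp]
theorem realize_tP : (tP s t).realize v = mP (s.realize v) (t.realize v) :=
  Term.realize_functions_apply₂
@[simp]
theorem realize_tM : (tM s t).realize v = mM (s.realize v) (t.realize v) :=
  Term.realize_functions_apply₂
@[simp]
theorem realize_tJ : (tJ s t).realize v = mJ (s.realize v) (t.realize v) :=
  Term.realize_functions_apply₂
@[simp]
theorem realize_tN : (tN s).realize v = mN (s.realize v) :=
  Term.realize_functions_apply₁
@[simp]
theorem realize_tE : (tE : DMMLang.Term α).realize v = mE :=
  congrArg (funMap (L := DMMLang) DMMOp.e) (Subsingleton.elim _ _)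

theorem realize_tIsConst [Fact (IsDMM B)] :
    (tIsConst s).realize v = DeMorganMonoid.isConst (s.realize v) := by
  simp only [tIsConst, tBires, realize_tP, realize_tM, realize_tJ, realize_tN, realize_tE]
  rfl

theorem bool_realize_tIsConst (v : α → Bool) :
    (tM tE (tIsConst s)).realize v = true := by
  simp only [tIsConst, tBires, realize_tP, realize_tM, realize_tJ, realize_tN, realize_tE]
  generalize s.realize v = x
  revert x
  decide

theorem d4_realize_tIsConst (v : α → Fin 4) :
    (tM tE (tIsConst s)).realize v = (1 : Fin 4) := by
  simp only [tIsConst, tBires, realize_tP, realize_tM, realize_tJ, realize_tN, realize_tE]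
  generalize s.realize v = x
  revert x
  decide

theorem c4_mul_neg_one_ne (x : C4) :
    mM (mP (mN mE) x) (mP (mN mE) (mN x)) ≠ mP (mN mE) (mN mE) := by
  revert x
  decide

end Terms

/-! ### Passive structural completeness -/

section PassiveCompleteness

open DeMorganMonoid

variable {K : StructClass DMMLang}

instance : DMMLang.IsAlgebraic := fun _ => inferInstanceAs (IsEmpty Empty)

instance : Fact (IsDMM C4) := ⟨by unfold IsDMM mLe; decide⟩

theorem isPSC_of_hom {T : Type} [DMMLang.Structure T]
    (h₁ : ∀ (A : Type) [iA : DMMLang.Structure A], K A iA → Nontrivial A →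
      Nonempty (A →[DMMLang] T))
    (h₂ : ∀ (A : Type) [iA : DMMLang.Structure A], K A iA → Nontrivial A →
      Nonempty (T →[DMMLang] A)) : IsPSC K := fun A _ B _ hA hB nA nB φ hφ H => by
  obtain ⟨g⟩ := h₁ A hA nA
  obtain ⟨k⟩ := h₂ B hB nB
  exact hφ.sentence_hom (k.comp g) H

/-- The variable of an equation in one unknown. -/
def tX : DMMLang.Term (Empty ⊕ Fin 1) := Term.var (Sum.inr 0)

@[simp]
theorem realize_tX {B : Type} [DMMLang.Structure B] (x : B) :
    tX.realize (fun _ => x) = x := rfl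

section Transfer

variable (hpsc : IsPSC K) {A B : Type} [iA : DMMLang.Structure A] [iB : DMMLang.Structure B]
  [Fact (IsDMM A)] [Fact (IsDMM B)] (hA : K A iA) (hB : K B iB) [Nontrivial A] [Nontrivial B]
include hpsc hA hB

theorem IsPSC.one_le_neg_one (h : (1 : A) ≤ -1) : (1 : B) ≤ -1 := by
  obtain ⟨x, hx⟩ := hpsc.exists_realize_eq hA hB (tM tE (tN tE)) tE ⟨1, by
    simp only [realize_tM, realize_tN, realize_tE]
    exact h⟩
  simp only [realize_tM, realize_tN, realize_tE] at hx
  exact hx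

theorem IsPSC.neg_one_le_one (h : (-1 : A) ≤ 1) : (-1 : B) ≤ 1 := by
  obtain ⟨x, hx⟩ := hpsc.exists_realize_eq hA hB (tM (tN tE) tE) (tN tE) ⟨1, by
    simp only [realize_tM, realize_tN, realize_tE]
    exact h⟩
  simp only [realize_tM, realize_tN, realize_tE] at hx
  exact hx

end Transfer

theorem IsPSC.eq_const (hpsc : IsPSC K) {B T : Type} [iB : DMMLang.Structure B]
    [iT : DMMLang.Structure T] [Fact (IsDMM B)] (hB : K B iB) (hT : K T iT) [Nontrivial B]
    [Nontrivial T]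
    (hTc : ∀ x : T, (tM tE (tIsConst tX)).realize (fun _ => x) ≠ mM mE (mN mE))
    (hbot : ∀ x : B, 1 ⊓ -1 ≤ x) (hp : ∀ x y : B, 1 ≤ x ⊔ y → 1 ≤ x ∨ 1 ≤ y) (x : B) :
    x = 1 ⊓ -1 ∨ x = 1 ∨ x = -1 ∨ x = 1 ⊔ -1 := by
  refine eq_const_of_one_le_isConst hp ((hp _ _ (one_le_sup_neg _)).resolve_right fun h => ?_)
  obtain ⟨y, hy⟩ := hpsc.exists_realize_eq hB hT (tM tE (tIsConst tX)) (tM tE (tN tE)) ⟨x, by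
    rw [realize_tM, realize_tIsConst, realize_tM, realize_tN, realize_tE]
    exact le_antisymm (inf_le_inf_left 1 (le_neg_comm.1 h)) (hbot _)⟩
  refine hTc y (hy.trans ?_)
  rw [realize_tM, realize_tN, realize_tE]

theorem isOddSugihara_of_eq {B : Type} [DMMLang.Structure B] [hB : Fact (IsDMM B)]
    (h : (-1 : B) = 1) : IsOddSugihara B :=
  ⟨hB.out, mul_self_eq_of_neg_one_le h.le, h⟩

theorem isPSC_of_cond3 (h : Cond3 K) : IsPSC K := fun A iA B iB _ hB _ _ φ hφ H => by
  obtain ⟨⟨h1, h2, h3, h4, h5, h6, -⟩, hid, hN⟩ := h B iB hB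
  have hM : mM (mE : B) mE = mE := by
    conv_lhs => arg 2; rw [← h6 mE mE]
    exact h5 _ _
  have hJ : mJ (mE : B) mE = mE := by
    conv_lhs => arg 2; rw [← hM]
    exact h6 _ _
  exact hφ.sentence_hom (mkHom (A := A) (fun _ => (mE : B)) (fun _ _ => (hid _).symm)
    (fun _ _ => hM.symm) (fun _ _ => hJ.symm) (fun _ => hN.symm) rfl) H

variable (hK : IsVariety K)
  (hdmm : ∀ (B : Type) (iB : DMMLang.Structure B), K B iB → @IsDMM B iB)
include hK hdmm

theorem le_of_forall_not_one_le {A : Type} [iA : DMMLang.Structure A] [Fact (IsDMM A)]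
    (hA : K A iA) {g : A} (hg : g ≤ 1)
    (H : ∀ (B : Type) [iB : DMMLang.Structure B] [Fact (IsDMM B)] (h : A →[DMMLang] B),
      K B iB → Nontrivial B → ¬ 1 ≤ h g) (x : A) : g ≤ x := by
  obtain ⟨B, iB, _, h, hB, -, hF⟩ := exists_principal_quotient hK hdmm hA hg
  rcases subsingleton_or_nontrivial B with _ | hn
  · exact (hF x).1 (Subsingleton.elim 1 (h x)).le
  · exact (H B h hB hn ((hF g).2 le_rfl)).elim

theorem exists_prime_quotient {A : Type} [iA : DMMLang.Structure A] [Fact (IsDMM A)]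
    (hA : K A iA) {d : A} (hd : ¬ 1 ≤ d) :
    ∃ (B : Type) (iB : DMMLang.Structure B) (_ : Fact (IsDMM B)) (h : A →[DMMLang] B),
      K B iB ∧ ¬ 1 ≤ h d ∧ Nontrivial B ∧ ∀ x y : B, 1 ≤ x ⊔ y → 1 ≤ x ∨ 1 ≤ y := by
  obtain ⟨B, iB, hF, h, hB, hd', hn, hs⟩ := exists_maximal_quotient hK hdmm hA hd
  exact ⟨B, iB, hF, h, hB, hd', hn, eq_of_forall_one_le_or hd' hs⟩

theorem exists_const_quotient {A : Type} [iA : DMMLang.Structure A] [Fact (IsDMM A)]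
    (hc : ∀ (B : Type) [iB : DMMLang.Structure B] [Fact (IsDMM B)], K B iB →
      ∀ x : B, 1 ≤ isConst x) (hA : K A iA) {d : A} (hd : ¬ 1 ≤ d) :
    ∃ (B : Type) (iB : DMMLang.Structure B) (_ : Fact (IsDMM B)) (_ : A →[DMMLang] B),
      K B iB ∧ Nontrivial B ∧ ∀ x : B, x = 1 ⊓ -1 ∨ x = 1 ∨ x = -1 ∨ x = 1 ⊔ -1 := by
  obtain ⟨B, iB, hF, h, hB, -, hn, hp⟩ := exists_prime_quotient hK hdmm hA hd
  exact ⟨B, iB, hF, h, hB, hn, fun x => eq_const_of_one_le_isConst hp (hc B hB x)⟩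

/-- `K` is generated by its member `T` when all irreducible members are isomorphic to `T`. -/
theorem eqClass_vGen_of_prime {T : Type} [iT : DMMLang.Structure T] (hT : K T iT)
    (H : ∀ (B : Type) [iB : DMMLang.Structure B] [Fact (IsDMM B)], K B iB → Nontrivial B →
      (∀ x y : B, 1 ≤ x ⊔ y → 1 ≤ x ∨ 1 ≤ y) → Nonempty (B ≃[DMMLang] T)) :
    EqClass K (VGen (ClassOf T)) := by
  refine eqClass_vGen hK hT fun A iA hA a b hab => ?_
  have : Fact (IsDMM A) := ⟨hdmm A iA hA⟩
  have key : ∀ a b : A, ¬ a ≤ b → ∃ h : A →[DMMLang] T, h a ≠ h b := fun a b hab => by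
    obtain ⟨B, iB, _, h, hB, hd, hn, hp⟩ :=
      exists_prime_quotient hK hdmm hA (fun h => hab (one_le_res_iff.1 h) : ¬ 1 ≤ res a b)
    obtain ⟨g⟩ := H B hB hn hp
    refine ⟨g.toHom.comp h, fun h' => hd ?_⟩
    have : h a = h b := g.injective h'
    rw [res, hom_neg, hom_mul, hom_neg, this]
    exact one_le_res_iff.2 le_rfl
  by_cases h : a ≤ b
  · obtain ⟨g, hg⟩ := key b a fun h' => hab (le_antisymm h h')
    exact ⟨g, hg.symm⟩
  · exact key a b h

theorem isPSC_of_cond1 (h : Cond1 K) : IsPSC K := by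
  have hbot : ∀ (A : Type) [iA : DMMLang.Structure A] [Fact (IsDMM A)], K A iA →
      ∀ x : A, -1 ≤ x := fun A iA _ hA x => by
    have := VGen.realize_eq (tM (tN tE) tX) (tN tE) (fun v => by
      simp only [realize_tM, realize_tN, realize_tE]
      generalize tX.realize v = x
      revert x
      decide) ((h A iA).1 hA) fun _ => x
    simp only [realize_tM, realize_tN, realize_tE, realize_tX] at this
    exact this
  have hc : ∀ (A : Type) [iA : DMMLang.Structure A] [Fact (IsDMM A)], K A iA →
      ∀ x : A, 1 ≤ isConst x := fun A iA _ hA x => by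
    have := VGen.realize_eq (tM tE (tIsConst tX)) tE (fun v =>
      (bool_realize_tIsConst tX v).trans (realize_tE v).symm) ((h A iA).1 hA) fun _ => x
    rw [realize_tM, realize_tIsConst, realize_tE] at this
    exact inf_eq_left.1 this
  refine isPSC_of_hom (T := Bool) (fun A iA hA hn => ?_) fun A iA hA hn => ?_
  all_goals have : Fact (IsDMM A) := ⟨hdmm A iA hA⟩
  · obtain ⟨B, iB, _, g, hB, hn, hB'⟩ :=
      exists_const_quotient hK hdmm hc hA (not_one_le_of_bot (hbot A hA))
    exact ⟨(equivOfBijective (boolHom (hbot B hB)) ⟨boolHom_injective _,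
      boolHom_surjective _ hB'⟩).symm.toHom.comp g⟩
  · exact ⟨boolHom (hbot A hA)⟩

theorem isPSC_of_cond2 (h : Cond2 K) : IsPSC K := by
  have htop : ∀ (A : Type) [iA : DMMLang.Structure A] [Fact (IsDMM A)], K A iA →
      ∀ x : A, x ≤ -1 * -1 := fun A iA _ hA x => by
    have := VGen.realize_eq (tM tX (tP (tN tE) (tN tE))) tX (fun v => by
      simp only [realize_tM, realize_tP, realize_tN, realize_tE]
      generalize tX.realize v = x
      revert x
      decide) ((h A iA).1 hA) fun _ => x
    simp only [realize_tM, realize_tP, realize_tN, realize_tE, realize_tX] at this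
    exact this
  have hef : ∀ (A : Type) [iA : DMMLang.Structure A] [Fact (IsDMM A)], K A iA →
      (1 : A) ⊓ -1 = -(-1 * -1) := fun A iA _ hA => by
    have := VGen.realize_eq (α := Empty) (tM tE (tN tE)) (tN (tP (tN tE) (tN tE))) (fun v => by
      simp only [realize_tM, realize_tP, realize_tN, realize_tE]
      decide) ((h A iA).1 hA) Empty.elim
    simp only [realize_tM, realize_tP, realize_tN, realize_tE] at this
    exact this
  have hc : ∀ (A : Type) [iA : DMMLang.Structure A] [Fact (IsDMM A)], K A iA →
      ∀ x : A, 1 ≤ isConst x := fun A iA _ hA x => by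
    have := VGen.realize_eq (tM tE (tIsConst tX)) tE (fun v =>
      (d4_realize_tIsConst tX v).trans (realize_tE v).symm) ((h A iA).1 hA) fun _ => x
    rw [realize_tM, realize_tIsConst, realize_tE] at this
    exact inf_eq_left.1 this
  refine isPSC_of_hom (T := Fin 4) (fun A iA hA hn => ?_) fun A iA hA hn => ?_
  all_goals have : Fact (IsDMM A) := ⟨hdmm A iA hA⟩
  · obtain ⟨B, iB, _, g, hB, hn, hB'⟩ :=
      exists_const_quotient hK hdmm hc hA (not_one_le_bot (htop A hA))
    exact ⟨(equivOfBijective (d4Hom (htop B hB) (hef B hB)) ⟨d4Hom_injective _ _,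
      d4Hom_surjective _ _ hB'⟩).symm.toHom.comp g⟩
  · exact ⟨d4Hom (htop A hA) (hef A hA)⟩

theorem isPSC_of_cond4 (h : Cond4 K) : IsPSC K := by
  have htop : ∀ (A : Type) [iA : DMMLang.Structure A] [Fact (IsDMM A)], K A iA →
      ∀ x : A, x ≤ -1 * -1 := fun A iA _ hA => (h.2 A iA hA).2.2.1
  have hef : ∀ (A : Type) [iA : DMMLang.Structure A] [Fact (IsDMM A)], K A iA →
      (1 : A) ≤ -1 := fun A iA _ hA => (h.2 A iA hA).2.1
  refine isPSC_of_hom (T := C4) (fun A iA hA hn => ?_) fun A iA hA hn => ?_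
  all_goals have : Fact (IsDMM A) := ⟨hdmm A iA hA⟩
  · obtain ⟨B, iB, _, g, hB, hd, hn, hs⟩ :=
      exists_maximal_quotient hK hdmm hA (not_one_le_bot (htop A hA))
    simp only [hom_neg, hom_mul, hom_one] at hs
    have hN : ∀ x : B, -1 * x = -1 * -1 → -1 * -x ≠ -1 * -1 := fun x h₁ h₂ => by
      have h3 : (-1 * -1 : B) * -(-1 * x ⊓ -1 * -x) = -1 * -1 := (h.2 B iB hB).2.2.2 x
      rw [h₁, h₂, inf_idem, mul_comm, bot_mul (htop B hB)] at h3
      exact not_one_le_bot (htop B hB) ((htop B hB 1).trans h3.ge)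
    exact ⟨(equivOfBijective (c4Hom (htop B hB) (hef B hB)) ⟨c4Hom_injective _ _,
      four_surjective (eq_const_of_simple (htop B hB) hs (hef B hB) hN)⟩).symm.toHom.comp g⟩
  · exact ⟨c4Hom (htop A hA) (hef A hA)⟩

theorem IsPSC.cond4 (hpsc : IsPSC K) {A₀ : Type} [iA₀ : DMMLang.Structure A₀] [Fact (IsDMM A₀)]
    (hA₀ : K A₀ iA₀) [Nontrivial A₀] (hef₀ : (1 : A₀) ≤ -1) (hne₀ : ¬ (-1 : A₀) ≤ 1) :
    Cond4 K := by
  have htop : ∀ (A : Type) [iA : DMMLang.Structure A] [Fact (IsDMM A)], K A iA →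
      Nontrivial A → ∀ x : A, x ≤ -1 * -1 := fun A iA _ hA hn x => by
    have hg : -(-1 * -1) ≤ (1 : A) := neg_le_comm.1 (le_mul_self _)
    refine neg_le_neg_iff.1 (le_of_forall_not_one_le hK hdmm hA hg (fun B iB _ h hB hn' h1 => ?_) _)
    rw [hom_neg, hom_mul, hom_neg, hom_one, le_neg_comm, neg_one_mul_le_neg_one_iff] at h1
    exact hne₀ (hpsc.neg_one_le_one hB hA₀ h1)
  have hC4 : K C4 c4Struct := hK.sub_closed C4 A₀
    ⟨embeddingOfInjective _ (c4Hom_injective (htop A₀ hA₀ inferInstance) hef₀)⟩ hA₀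
  refine ⟨⟨A₀, iA₀, hA₀, inferInstance⟩, fun A iA hA => ?_⟩
  have hF : Fact (IsDMM A) := ⟨hdmm A iA hA⟩
  refine ⟨hF.out, ?_⟩
  rcases subsingleton_or_nontrivial A with _ | hn
  · exact ⟨Subsingleton.elim _ _, fun _ => Subsingleton.elim _ _, fun _ => Subsingleton.elim _ _⟩
  refine ⟨hpsc.one_le_neg_one hA₀ hA hef₀, htop A hA hn, fun x => ?_⟩
  change (-1 * -1 : A) * -(-1 * x ⊓ -1 * -x) = -1 * -1
  by_contra hne
  have hd : ¬ 1 ≤ res (-1 * -1) (-1 * -1 * -(-1 * x ⊓ -1 * -x)) := fun h =>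
    hne (le_antisymm (htop A hA hn _) (one_le_res_iff.1 h))
  obtain ⟨B, iB, _, h, hB, hd', hn', hp⟩ := exists_prime_quotient hK hdmm hA hd
  simp only [res, hom_neg, hom_mul, hom_inf, hom_one] at hd'
  have hbot := eq_bot_of_top_mul_ne hp (htop B hB hn') (w := -(-1 * h x ⊓ -1 * -h x))
    fun h' => hd' (one_le_res_iff.2 h'.ge)
  obtain ⟨y, hy⟩ := hpsc.exists_realize_eq hB hC4
    (tM (tP (tN tE) tX) (tP (tN tE) (tN tX))) (tP (tN tE) (tN tE)) ⟨h x, by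
      simp only [realize_tM, realize_tP, realize_tN, realize_tE, realize_tX]
      exact neg_injective hbot⟩
  exact c4_mul_neg_one_ne y (by simpa using hy)

theorem IsPSC.cond1_or_cond2 (hpsc : IsPSC K) {A₀ : Type} [iA₀ : DMMLang.Structure A₀]
    [Fact (IsDMM A₀)] (hA₀ : K A₀ iA₀) [Nontrivial A₀] (hef₀ : ¬ (1 : A₀) ≤ -1) :
    Cond1 K ∨ Cond2 K := by
  have hbot : ∀ (A : Type) [iA : DMMLang.Structure A] [Fact (IsDMM A)], K A iA →
      Nontrivial A → ∀ x : A, 1 ⊓ -1 ≤ x := fun A iA _ hA hn =>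
    le_of_forall_not_one_le hK hdmm hA inf_le_left fun B iB _ h hB hn' h1 => by
      rw [hom_inf, hom_neg, hom_one] at h1
      exact hef₀ (hpsc.one_le_neg_one hB hA₀ (h1.trans inf_le_right))
  obtain ⟨B₀, iB₀, _, -, hB₀, -, hn, hp⟩ := exists_prime_quotient hK hdmm hA₀
    (fun h => hef₀ (h.trans inf_le_right) : ¬ (1 : A₀) ≤ 1 ⊓ -1)
  by_cases hfe₀ : (-1 : B₀) ≤ 1
  · left
    have hbot' : ∀ (A : Type) [iA : DMMLang.Structure A] [Fact (IsDMM A)], K A iA →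
        Nontrivial A → ∀ x : A, -1 ≤ x := fun A iA _ hA hn x => by
      rw [← inf_eq_right.2 (hpsc.neg_one_le_one hB₀ hA hfe₀)]
      exact hbot A hA hn x
    have hT : K Bool boolStruct := hK.sub_closed Bool B₀
      ⟨embeddingOfInjective _ (boolHom_injective (hbot' B₀ hB₀ hn))⟩ hB₀
    refine eqClass_vGen_of_prime hK hdmm hT fun B iB _ hB hn hp =>
      ⟨(equivOfBijective _ ⟨boolHom_injective (hbot' B hB hn), boolHom_surjective _
        (hpsc.eq_const hB hT (fun x => ?_) (hbot B hB hn) hp)⟩).symm⟩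
    rw [bool_realize_tIsConst]
    decide
  · right
    have hd4 : ∀ (B : Type) [iB : DMMLang.Structure B] [Fact (IsDMM B)], K B iB → Nontrivial B →
        (∀ x y : B, 1 ≤ x ⊔ y → 1 ≤ x ∨ 1 ≤ y) →
        (∀ x : B, x ≤ -1 * -1) ∧ (1 : B) ⊓ -1 = -(-1 * -1) := fun B iB _ hB hn hp =>
      d4_of_irreducible (hbot B hB hn) hp fun h => hfe₀ (hpsc.neg_one_le_one hB hB₀ h)
    have hT : K (Fin 4) d4Struct := hK.sub_closed (Fin 4) B₀
      ⟨embeddingOfInjective _ (d4Hom_injective (hd4 B₀ hB₀ hn hp).1 (hd4 B₀ hB₀ hn hp).2)⟩ hB₀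
    refine eqClass_vGen_of_prime hK hdmm hT fun B iB _ hB hn hp =>
      ⟨(equivOfBijective _ ⟨d4Hom_injective (hd4 B hB hn hp).1 (hd4 B hB hn hp).2,
        d4Hom_surjective _ _
          (hpsc.eq_const hB hT (fun x => ?_) (hbot B hB hn) hp)⟩).symm⟩
    rw [d4_realize_tIsConst]
    decide

theorem IsPSC.cond (hpsc : IsPSC K) : Cond1 K ∨ Cond2 K ∨ Cond3 K ∨ Cond4 K := by
  by_cases hodd : ∀ (B : Type) [iB : DMMLang.Structure B] [Fact (IsDMM B)], K B iB →
      (-1 : B) = 1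
  · exact .inr (.inr (.inl fun B iB hB =>
      have : Fact (IsDMM B) := ⟨hdmm B iB hB⟩
      isOddSugihara_of_eq (hodd B hB)))
  push Not at hodd
  obtain ⟨A, iA, _, hA, hne⟩ := hodd
  have : Nontrivial A := ⟨_, _, hne⟩
  by_cases hef : (1 : A) ≤ -1
  · exact .inr (.inr (.inr (hpsc.cond4 hK hdmm hA hef fun h => hne (le_antisymm h hef))))
  · rcases hpsc.cond1_or_cond2 hK hdmm hA hef with h | h
    exacts [.inl h, .inr (.inl h)]

end PassiveCompleteness

/-- a variety of De Morgan monoids is PSC iff exactly one of the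
four conditions holds: it is the variety of Boolean algebras, or `V(D₄)`, or
consists of odd Sugihara monoids, or is a nontrivial subvariety of `M`. -/
theorem statement_18 (K : StructClass DMMLang) (hK : IsVariety K)
    (hdmm : ∀ (B : Type) (iB : DMMLang.Structure B), K B iB → @IsDMM B iB) :
    (IsPSC K ↔ (Cond1 K ∨ Cond2 K ∨ Cond3 K ∨ Cond4 K)) ∧
    ¬(Cond1 K ∧ Cond2 K) ∧ ¬(Cond1 K ∧ Cond3 K) ∧ ¬(Cond1 K ∧ Cond4 K) ∧
    ¬(Cond2 K ∧ Cond3 K) ∧ ¬(Cond2 K ∧ Cond4 K) ∧ ¬(Cond3 K ∧ Cond4 K) := by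
  have hT₁ : Cond1 K → K Bool boolStruct := fun h => (h _ _).2 (VGen.self Bool)
  have hT₂ : Cond2 K → K (Fin 4) d4Struct := fun h => (h _ _).2 (VGen.self (Fin 4))
  refine ⟨⟨IsPSC.cond hK hdmm, ?_⟩, ?_, ?_, ?_, ?_, ?_, ?_⟩
  · rintro (h | h | h | h)
    exacts [isPSC_of_cond1 hK hdmm h, isPSC_of_cond2 hK hdmm h, isPSC_of_cond3 h,
      isPSC_of_cond4 hK hdmm h]
  · rintro ⟨h₁, h₂⟩
    have := VGen.realize_eq (tP (tN tE) (tN tE)) (tN tE) (fun v => by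
      simp only [realize_tP, realize_tN, realize_tE]
      decide) ((h₁ _ _).1 (hT₂ h₂)) fun e : Empty => e.elim
    simp only [realize_tP, realize_tN, realize_tE] at this
    exact absurd this (by decide)
  · rintro ⟨h₁, h₃⟩
    exact absurd (h₃ _ _ (hT₁ h₁)).2.2 (by decide)
  · rintro ⟨h₁, h₄⟩
    exact absurd (h₄.2 _ _ (hT₁ h₁)).2.1 (by unfold mLe; decide)
  · rintro ⟨h₂, h₃⟩
    exact absurd (h₃ _ _ (hT₂ h₂)).2.2 (by decide)
  · rintro ⟨h₂, h₄⟩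
    exact absurd (h₄.2 _ _ (hT₂ h₂)).2.1 (by unfold mLe; decide)
  · rintro ⟨h₃, ⟨B, iB, hB, hn⟩, h₄⟩
    have : Fact (IsDMM B) := ⟨hdmm B iB hB⟩
    have h1 : (-1 : B) = 1 := (h₃ B iB hB).2.2
    apply DeMorganMonoid.not_one_le_bot (h₄ B iB hB).2.2.1
    rw [h1, mul_one, h1]

end Paper
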